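/- arXiv:math/9601201 — 3 statements merged into one kernel-verified Lean document; each statement's English description precedes it below -/
import Mathlib

section
/- Let (W,S) be a Coxeter system, let X, X' ⊆ S, and let v ∈ W be (X,X')-reduced, i.e. v has minimal length in the double coset W_X v W_{X'}. Then W_X ∩ (v W_{X'} v^{-1}) = W_Y, where Y = (v X' v^{-1}) ∩ X. -/
open scoped Pointwise

namespace CoxeterCommensurator

variable {B W : Type*} [Group W]

/-- The standard parabolic subgroup `W_X` of the Coxeter system `cs`, generated by the
simple reflections indexed by `X`. -/
def parab {M : CoxeterMatrix B} (cs : CoxeterSystem M W) (X : Set B) : Subgroup W :=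
  Subgroup.closure (cs.simple '' X)

section Exchange

theorem end_mul_apply {α : Type*} (f g : Function.End α) (x : α) : (f * g) x = f (g x) := rfl

theorem end_one_apply {α : Type*} (x : α) : (1 : Function.End α) x = x := rfl

variable {M : CoxeterMatrix B} (cs : CoxeterSystem M W)

open Classical in
/-- The action of a simple reflection on pairs `(t, ε)`: conjugate `t`, and flip the sign `ε`
when `t` is that simple reflection. -/
noncomputable def signedConj (i : B) : Function.End (W × ZMod 2) := fun p =>
  (cs.simple i * p.1 * cs.simple i, p.2 + if p.1 = cs.simple i then 1 else 0)

theorem inv_simple_mul_simple_pow (i j : B) (n : ℕ) :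
    ((cs.simple i * cs.simple j) ^ n)⁻¹
      = cs.simple j * (cs.simple i * cs.simple j) ^ n * cs.simple j := by
  have h := conj_pow (i := n) (a := cs.simple j) (b := cs.simple i * cs.simple j)
  rw [cs.inv_simple] at h
  rw [← h, ← inv_pow]
  simp [mul_assoc]

open Classical in
theorem signedConj_mul_pow_apply (i j : B) (n : ℕ) (p : W × ZMod 2) :
    ((signedConj cs i * signedConj cs j) ^ n) p
      = ((cs.simple i * cs.simple j) ^ n * p.1 * ((cs.simple i * cs.simple j) ^ n)⁻¹,
        p.2 + ∑ k ∈ Finset.range (2 * n),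
          if p.1 = cs.simple j * (cs.simple i * cs.simple j) ^ k then 1 else 0) := by
  induction n with
  | zero => simp [end_one_apply]
  | succ n ih =>
    set c := cs.simple i * cs.simple j with hc
    have hinv := inv_simple_mul_simple_pow cs i j n
    rw [← hc] at hinv
    have h₁ : c ^ n * p.1 * (c ^ n)⁻¹ = cs.simple j ↔ p.1 = cs.simple j * c ^ (2 * n) := by
      rw [mul_inv_eq_iff_eq_mul, ← eq_inv_mul_iff_mul_eq, hinv, two_mul, pow_add]
      simp [mul_assoc]
    have h₂ : cs.simple j * (c ^ n * p.1 * (c ^ n)⁻¹) * cs.simple j = cs.simple i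
        ↔ p.1 = cs.simple j * c ^ (2 * n + 1) := by
      rw [← eq_mul_inv_iff_mul_eq, ← eq_inv_mul_iff_mul_eq, mul_inv_eq_iff_eq_mul,
        ← eq_inv_mul_iff_mul_eq, hinv, show 2 * n + 1 = n + 1 + n by ring, pow_add, pow_succ]
      simp [mul_assoc, hc]
    rw [pow_succ', end_mul_apply, ih]
    ext
    · simp [signedConj, end_mul_apply, pow_succ', hc, mul_assoc]
    · simp only [signedConj, end_mul_apply, h₁, h₂]
      rw [show 2 * (n + 1) = 2 * n + 1 + 1 by ring, Finset.sum_range_succ,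
        Finset.sum_range_succ]
      ring

theorem isLiftable_signedConj : M.IsLiftable (signedConj cs) := by
  classical
  intro i j
  funext p
  rw [signedConj_mul_pow_apply, two_mul, Finset.sum_range_add]
  simp only [pow_add, cs.simple_mul_simple_pow, one_mul, inv_one, mul_one, ← two_mul]
  rw [show (2 : ZMod 2) = 0 from rfl]
  simp [end_one_apply]

/-- The action of `W` on pairs `(t, ε)` extending `signedConj`. -/
noncomputable def signedConjHom : W →* Function.End (W × ZMod 2) :=
  cs.lift ⟨signedConj cs, isLiftable_signedConj cs⟩

theorem signedConjHom_simple (i : B) : signedConjHom cs (cs.simple i) = signedConj cs i :=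
  cs.lift_apply_simple (isLiftable_signedConj cs) i

open Classical in
theorem signedConjHom_wordProd_apply (ω : List B) (p : W × ZMod 2) :
    signedConjHom cs (cs.wordProd ω) p
      = (cs.wordProd ω * p.1 * (cs.wordProd ω)⁻¹,
        p.2 + ((cs.rightInvSeq ω).count p.1 : ZMod 2)) := by
  induction ω with
  | nil => simp [end_one_apply]
  | cons i ω ih =>
    have h : cs.wordProd ω * p.1 * (cs.wordProd ω)⁻¹ = cs.simple i
        ↔ (cs.wordProd ω)⁻¹ * cs.simple i * cs.wordProd ω = p.1 := by
      rw [mul_inv_eq_iff_eq_mul, ← eq_inv_mul_iff_mul_eq, eq_comm, mul_assoc]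
    rw [cs.wordProd_cons, map_mul, end_mul_apply, ih,
      signedConjHom_simple]
    ext
    · simp [signedConj, mul_assoc]
    · simp only [signedConj, h, CoxeterSystem.rightInvSeq, List.count_cons, beq_iff_eq]
      push_cast
      ring

theorem signedConjHom_apply (w : W) (p : W × ZMod 2) :
    signedConjHom cs w p = (w * p.1 * w⁻¹, p.2 + (signedConjHom cs w (p.1, 0)).2) := by
  classical
  obtain ⟨ω, rfl⟩ := cs.wordProd_surjective w
  simp [signedConjHom_wordProd_apply]

theorem signedConjHom_mul_apply_snd (w u t : W) :
    (signedConjHom cs (w * u) (t, 0)).2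
      = (signedConjHom cs u (t, 0)).2 + (signedConjHom cs w (u * t * u⁻¹, 0)).2 := by
  rw [map_mul, end_mul_apply, signedConjHom_apply cs u,
    signedConjHom_apply cs w]

theorem signedConjHom_reflection_apply_snd {t : W} (ht : cs.IsReflection t) :
    (signedConjHom cs t (t, 0)).2 = 1 := by
  obtain ⟨u, i, rfl⟩ := ht
  have h : u⁻¹ * (u * cs.simple i * u⁻¹) * u⁻¹⁻¹ = cs.simple i := by group
  have h₁ := signedConjHom_mul_apply_snd cs u u⁻¹ (u * cs.simple i * u⁻¹)
  rw [h, mul_inv_cancel, map_one] at h₁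
  rw [signedConjHom_mul_apply_snd, h, signedConjHom_mul_apply_snd, signedConjHom_simple]
  have h₂ : (signedConj cs i (cs.simple i, 0)).2 = 1 := by simp [signedConj]
  rw [h₂, mul_inv_cancel_right]
  rw [end_one_apply] at h₁
  linear_combination -h₁

/-- A reflection moved by the sign action of `w` occurs in the inversion sequence of every word
for `w`. -/
theorem mem_rightInvSeq_of_signedConjHom_ne_zero {ω : List B} {t : W}
    (h : (signedConjHom cs (cs.wordProd ω) (t, 0)).2 ≠ 0) : t ∈ cs.rightInvSeq ω := by
  classical
  by_contra hn
  simp [signedConjHom_wordProd_apply, List.count_eq_zero_of_not_mem hn] at h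

theorem mem_rightInvSeq_of_isRightInversion {ω : List B} {t : W}
    (ht : cs.IsRightInversion (cs.wordProd ω) t) : t ∈ cs.rightInvSeq ω := by
  apply mem_rightInvSeq_of_signedConjHom_ne_zero
  intro h₀
  have h := signedConjHom_mul_apply_snd cs (cs.wordProd ω) t t
  rw [signedConjHom_reflection_apply_snd cs ht.1, mul_inv_cancel_right, h₀, add_zero] at h
  obtain ⟨ω', hω', hw⟩ := cs.exists_isReduced (cs.wordProd ω * t)
  rw [hw] at h
  have hmem := mem_rightInvSeq_of_signedConjHom_ne_zero cs (h.trans_ne one_ne_zero)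
  have hinv := cs.isRightInversion_of_mem_rightInvSeq hω' hmem
  rw [← hw, ht.1.isRightInversion_mul_left_iff] at hinv
  exact hinv ht

/-- The strong exchange condition. -/
theorem exists_wordProd_mul_eq_eraseIdx {ω : List B} {t : W}
    (ht : cs.IsRightInversion (cs.wordProd ω) t) :
    ∃ k < ω.length, cs.wordProd ω * t = cs.wordProd (ω.eraseIdx k) := by
  obtain ⟨k, hk, rfl⟩ := List.mem_iff_getElem.mp (mem_rightInvSeq_of_isRightInversion cs ht)
  refine ⟨k, by simpa using hk, ?_⟩
  rw [← cs.wordProd_mul_getD_rightInvSeq, List.getD_eq_getElem _ _ hk]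

theorem exists_simple_mul_wordProd_eq_eraseIdx {ω : List B} {i : B}
    (h : cs.IsLeftDescent (cs.wordProd ω) i) :
    ∃ k < ω.length, cs.simple i * cs.wordProd ω = cs.wordProd (ω.eraseIdx k) := by
  have heq : cs.wordProd ω * ((cs.wordProd ω)⁻¹ * cs.simple i * (cs.wordProd ω)⁻¹⁻¹)
      = cs.simple i * cs.wordProd ω := by group
  rw [← heq]
  refine exists_wordProd_mul_eq_eraseIdx cs ⟨(cs.isReflection_simple i).conj _, ?_⟩
  rwa [heq]

end Exchange

section Parabolic

variable {M : CoxeterMatrix B} (cs : CoxeterSystem M W) {X : Set B}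

theorem simple_mem_parab {i : B} (hi : i ∈ X) : cs.simple i ∈ parab cs X :=
  Subgroup.subset_closure ⟨i, hi, rfl⟩

theorem wordProd_mem_parab {ω : List B} (hω : ∀ i ∈ ω, i ∈ X) :
    cs.wordProd ω ∈ parab cs X := by
  apply Subgroup.list_prod_mem
  simp only [List.mem_map]
  rintro _ ⟨i, hi, rfl⟩
  exact simple_mem_parab cs (hω i hi)

/-- Every element of a standard parabolic subgroup has a reduced word with letters in it. -/
theorem exists_isReduced_of_mem_parab {u : W} (hu : u ∈ parab cs X) :
    ∃ ω : List B, cs.IsReduced ω ∧ (∀ i ∈ ω, i ∈ X) ∧ u = cs.wordProd ω := by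
  have simple_mul : ∀ i ∈ X, ∀ w : W,
      (∃ ω : List B, cs.IsReduced ω ∧ (∀ i ∈ ω, i ∈ X) ∧ w = cs.wordProd ω) →
      ∃ ω : List B, cs.IsReduced ω ∧ (∀ i ∈ ω, i ∈ X) ∧ cs.simple i * w = cs.wordProd ω := by
    rintro i hi _ ⟨ω, hω, hωX, rfl⟩
    have hred : cs.length (cs.wordProd ω) = ω.length := hω
    by_cases hd : cs.IsLeftDescent (cs.wordProd ω) i
    · obtain ⟨k, hk, heq⟩ := exists_simple_mul_wordProd_eq_eraseIdx cs hd
      refine ⟨ω.eraseIdx k, ?_, fun j hj => hωX j (List.mem_of_mem_eraseIdx hj), heq⟩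
      have h₁ := cs.isLeftDescent_iff.mp hd
      have h₂ := List.length_eraseIdx_add_one hk
      rw [CoxeterSystem.IsReduced, ← heq]
      lia
    · refine ⟨i :: ω, ?_, by simpa [hi] using hωX, (cs.wordProd_cons i ω).symm⟩
      rw [CoxeterSystem.IsReduced, cs.wordProd_cons, cs.not_isLeftDescent_iff.mp hd, hred,
        List.length_cons]
  induction hu using Subgroup.closure_induction_left with
  | one => exact ⟨[], by simp [CoxeterSystem.IsReduced], by simp, by simp⟩
  | mul_left x hx y _ ih =>
    obtain ⟨i, hi, rfl⟩ := hx
    exact simple_mul i hi y ih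
  | inv_mul_cancel x hx y _ ih =>
    obtain ⟨i, hi, rfl⟩ := hx
    rw [cs.inv_simple]
    exact simple_mul i hi y ih

theorem exists_simple_of_mem_parab_of_length_eq_one {u : W} (hu : u ∈ parab cs X)
    (hlen : cs.length u = 1) : ∃ i ∈ X, u = cs.simple i := by
  obtain ⟨ω, hω, hωX, rfl⟩ := exists_isReduced_of_mem_parab cs hu
  rw [hω.eq] at hlen
  obtain ⟨i, rfl⟩ := List.length_eq_one_iff.mp hlen
  exact ⟨i, hωX i (by simp), by simp⟩

/-- Lengths add when the left factor is minimal in its coset modulo a standard parabolic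
subgroup containing the right factor. -/
theorem length_mul_of_mem_parab {v : W} (hv : ∀ u ∈ parab cs X, cs.length v ≤ cs.length (v * u))
    {u : W} (hu : u ∈ parab cs X) : cs.length (v * u) = cs.length v + cs.length u := by
  obtain ⟨ω, hω, hωX, rfl⟩ := exists_isReduced_of_mem_parab cs hu
  clear hu
  induction ω using List.reverseRecOn with
  | nil => simp
  | append_singleton ω i ih =>
    have hω' : cs.IsReduced ω := by simpa using hω.take ω.length
    have hωX' : ∀ j ∈ ω, j ∈ X := fun j hj => hωX j (by simp [hj])
    have hi : i ∈ X := hωX i (by simp)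
    have hsum := ih hω' hωX'
    have hlen : cs.length (cs.wordProd (ω ++ [i])) = ω.length + 1 := by simpa using hω.eq
    have hprod : cs.wordProd (ω ++ [i]) = cs.wordProd ω * cs.simple i := by
      simp [cs.wordProd_append]
    rw [hω'.eq] at hsum
    suffices ¬ cs.IsRightDescent (v * cs.wordProd ω) i by
      rw [hlen, hprod, ← mul_assoc, cs.not_isRightDescent_iff.mp this, hsum, add_assoc]
    intro hd
    obtain ⟨α, hα, rfl⟩ := cs.exists_isReduced v
    rw [← cs.wordProd_append, ← cs.isRightInversion_simple_iff_isRightDescent] at hd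
    obtain ⟨k, hk, heq⟩ := exists_wordProd_mul_eq_eraseIdx cs hd
    rw [List.length_append] at hk
    rw [cs.wordProd_append] at heq
    rcases lt_or_ge k α.length with hkα | hkα
    · rw [List.eraseIdx_append_of_lt_length hkα, cs.wordProd_append] at heq
      have hmem := mul_mem (mul_mem (wordProd_mem_parab cs hωX') (simple_mem_parab cs hi))
        (inv_mem (wordProd_mem_parab cs hωX'))
      have hmin := hv _ hmem
      rw [← mul_assoc, ← mul_assoc, heq, mul_inv_cancel_right, hα.eq] at hmin
      have h₁ := cs.length_wordProd_le (α.eraseIdx k)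
      have h₂ := List.length_eraseIdx_add_one hkα
      lia
    · rw [List.eraseIdx_append_of_length_le hkα, cs.wordProd_append, mul_assoc,
        mul_right_inj, ← hprod] at heq
      have h₁ := cs.length_wordProd_le (ω.eraseIdx (k - α.length))
      have h₂ := List.length_eraseIdx_le ω (k - α.length)
      rw [← heq, hlen] at h₁
      lia

theorem length_mul_of_mem_parab_left {v : W}
    (hv : ∀ u ∈ parab cs X, cs.length v ≤ cs.length (u * v))
    {u : W} (hu : u ∈ parab cs X) : cs.length (u * v) = cs.length u + cs.length v := by
  rw [← cs.length_inv (u * v), mul_inv_rev, length_mul_of_mem_parab cs (X := X) _ (inv_mem hu),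
    cs.length_inv, cs.length_inv, add_comm]
  intro x hx
  rw [cs.length_inv, ← cs.length_inv (v⁻¹ * x), mul_inv_rev, inv_inv]
  exact hv _ (inv_mem hx)

/-- A simple reflection shortening `v * u`, but not `v`, is conjugated by `v` to a simple
reflection of the standard parabolic subgroup containing `u`. -/
theorem exists_conj_simple_eq_of_isLeftDescent {v u : W} {i : B}
    (hv : ∀ x ∈ parab cs X, cs.length v ≤ cs.length (v * x)) (hu : u ∈ parab cs X)
    (hvi : ¬ cs.IsLeftDescent v i) (hd : cs.IsLeftDescent (v * u) i) :
    ∃ j ∈ X, v * cs.simple j * v⁻¹ = cs.simple i := by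
  obtain ⟨α, hα, rfl⟩ := cs.exists_isReduced v
  obtain ⟨ω, -, hωX, rfl⟩ := exists_isReduced_of_mem_parab cs hu
  rw [← cs.wordProd_append] at hd
  obtain ⟨k, -, heq⟩ := exists_simple_mul_wordProd_eq_eraseIdx cs hd
  rw [cs.wordProd_append, ← mul_assoc] at heq
  rcases lt_or_ge k α.length with hkα | hkα
  · rw [List.eraseIdx_append_of_lt_length hkα, cs.wordProd_append, mul_left_inj] at heq
    refine absurd ?_ hvi
    have h₁ := cs.length_wordProd_le (α.eraseIdx k)
    have h₂ := List.length_eraseIdx_add_one hkα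
    rw [CoxeterSystem.IsLeftDescent, heq, hα.eq]
    lia
  · rw [List.eraseIdx_append_of_length_le hkα, cs.wordProd_append] at heq
    have hmem : cs.wordProd (ω.eraseIdx (k - α.length)) * (cs.wordProd ω)⁻¹ ∈ parab cs X :=
      mul_mem (wordProd_mem_parab cs fun j hj => hωX j (List.mem_of_mem_eraseIdx hj))
        (inv_mem hu)
    rw [← eq_mul_inv_iff_mul_eq, mul_assoc] at heq
    have hlen := length_mul_of_mem_parab cs hv hmem
    rw [← heq, cs.not_isLeftDescent_iff.mp hvi, add_right_inj] at hlen
    obtain ⟨j, hj, hjeq⟩ := exists_simple_of_mem_parab_of_length_eq_one cs hmem hlen.symm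
    exact ⟨j, hj, by rw [← hjeq, ← heq, mul_inv_cancel_right]⟩

end Parabolic

/-- **Proposition 3.3 (Solomon).** If `v` is `(X, X')`-reduced, then
`W_X ∩ (v W_{X'} v⁻¹) = W_Y`, where `Y = (v X' v⁻¹) ∩ X`. -/
theorem parabolic_inter_conj_parabolic {B W : Type*} [Group W]
    (M : CoxeterMatrix B) (cs : CoxeterSystem M W) (X X' : Set B) (v : W)
    (hv : ∀ u ∈ parab cs X, ∀ u' ∈ parab cs X', cs.length v ≤ cs.length (u * v * u')) :
    parab cs X ⊓ (parab cs X').map (MulAut.conj v).toMonoidHom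
      = parab cs {b : B | b ∈ X ∧ cs.simple b ∈ (fun t => v * t * v⁻¹) '' (cs.simple '' X')} := by
  have hvl : ∀ u ∈ parab cs X, cs.length v ≤ cs.length (u * v) := fun u hu => by
    simpa using hv u hu 1 (one_mem _)
  have hvr : ∀ u ∈ parab cs X', cs.length v ≤ cs.length (v * u) := fun u hu => by
    simpa using hv 1 (one_mem _) u hu
  apply le_antisymm
  · rintro w ⟨hw, u, hu, huw⟩
    obtain ⟨ω, hω, hωX, rfl⟩ := exists_isReduced_of_mem_parab cs hw
    clear hw
    induction ω generalizing u with
    | nil => simp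
    | cons i ω ih =>
      have hω' : cs.IsReduced ω := by simpa using hω.drop 1
      have hωX' : ∀ j ∈ ω, j ∈ X := fun j hj => hωX j (List.mem_cons_of_mem i hj)
      have hi : i ∈ X := hωX i List.mem_cons_self
      have huw' : v * u * v⁻¹ = cs.simple i * cs.wordProd ω := by
        rw [← cs.wordProd_cons]
        exact huw
      have hvu : v * u = cs.wordProd (i :: ω) * v := by
        rw [cs.wordProd_cons, ← huw', inv_mul_cancel_right]
      have hvi : ¬ cs.IsLeftDescent v i := (hvl _ (simple_mem_parab cs hi)).not_gt
      have hd : cs.IsLeftDescent (v * u) i := by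
        rw [CoxeterSystem.IsLeftDescent, hvu,
          length_mul_of_mem_parab_left cs hvl (wordProd_mem_parab cs hωX), hω.eq,
          cs.wordProd_cons, mul_assoc, cs.simple_mul_simple_cancel_left,
          length_mul_of_mem_parab_left cs hvl (wordProd_mem_parab cs hωX'), hω'.eq,
          List.length_cons]
        lia
      obtain ⟨j, hj, hji⟩ := exists_conj_simple_eq_of_isLeftDescent cs hvr hu hvi hd
      rw [cs.wordProd_cons]
      refine mul_mem (simple_mem_parab cs ⟨hi, _, ⟨j, hj, rfl⟩, hji⟩)
        (ih (cs.simple j * u) (mul_mem (simple_mem_parab cs hj) hu) hω' hωX' ?_)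
      calc v * (cs.simple j * u) * v⁻¹ = (v * cs.simple j * v⁻¹) * (v * u * v⁻¹) := by group
        _ = cs.wordProd ω := by rw [hji, huw', cs.simple_mul_simple_cancel_left]
  · rw [parab, Subgroup.closure_le]
    rintro _ ⟨i, ⟨hi, _, ⟨j, hj, rfl⟩, hji⟩, rfl⟩
    exact ⟨simple_mem_parab cs hi, cs.simple j, simple_mem_parab cs hj, hji⟩

end CoxeterCommensurator
end

section
/- Let (W,S) be a Coxeter system with canonical representation on V and root basis {e_s : s ∈ S}. Let X, X' ⊆ S and w ∈ W. Then w(E_X) = E_{X'} if and only if wXw^{-1} = X' and l(ws) > l(w) for all s ∈ X, where E_X = {e_s : s ∈ X} and E_{X'} = {e_s : s ∈ X'}. -/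
open scoped Pointwise

namespace CoxeterCommensurator

variable {B W : Type*} [Group W]

/-- The entries `B(e_i, e_j) = -cos (π / m i j)` of the bilinear form of the canonical
representation, with value `-1` when `m i j = ∞` (encoded by `m i j = 0`). -/
noncomputable def kform (M : CoxeterMatrix B) (i j : B) : ℝ :=
  if M i j = 0 then -1 else -Real.cos (Real.pi / (M i j : ℝ))

/-- The basis vector `e_i` of the space `V = B →₀ ℝ` of the canonical representation. -/
noncomputable def esimple (i : B) : B →₀ ℝ := Finsupp.single i 1

/-- `ρ` is the canonical representation of `(W, S)` on `V = B →₀ ℝ`: every simple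
reflection `s i` acts by `x ↦ x - 2 B(x, e_i) e_i`. -/
def IsCanonicalRep {M : CoxeterMatrix B} (cs : CoxeterSystem M W)
    (ρ : W →* ((B →₀ ℝ) →ₗ[ℝ] (B →₀ ℝ))) : Prop :=
  ∀ (i : B) (x : B →₀ ℝ),
    ρ (cs.simple i) x = x - (2 * x.sum fun j c => c * kform M j i) • esimple i

theorem kform_self (M : CoxeterMatrix B) (i : B) : kform M i i = 1 := by
  simp [kform]

theorem kform_comm (M : CoxeterMatrix B) (i j : B) : kform M i j = kform M j i := by
  simp only [kform, M.symmetric i j]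

/-- The symmetric bilinear form on `V = B →₀ ℝ` with matrix `kform M`. -/
noncomputable def bform (M : CoxeterMatrix B) : (B →₀ ℝ) →ₗ[ℝ] (B →₀ ℝ) →ₗ[ℝ] ℝ :=
  Finsupp.linearCombination ℝ fun i => Finsupp.linearCombination ℝ fun j => kform M i j

theorem bform_esimple_esimple (M : CoxeterMatrix B) (i j : B) :
    bform M (esimple i) (esimple j) = kform M i j := by
  simp [bform, esimple]

theorem bform_comm (M : CoxeterMatrix B) (x y : B →₀ ℝ) : bform M x y = bform M y x := by
  suffices bform M = (bform M).flip from LinearMap.congr_fun (LinearMap.congr_fun this x) y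
  ext i j
  simp [bform, kform_comm M i j]

theorem sum_mul_kform (M : CoxeterMatrix B) (x : B →₀ ℝ) (i : B) :
    (x.sum fun j c => c * kform M j i) = bform M x (esimple i) := by
  rw [bform_comm]
  simp [bform, esimple, Finsupp.linearCombination_apply, kform_comm M i]

theorem esimple_nonneg (i : B) : 0 ≤ esimple i :=
  Finsupp.single_nonneg.2 zero_le_one

theorem esimple_ne_zero (i : B) : esimple i ≠ 0 := by
  simp [esimple]

/-- The Chebyshev values `U_n(cos (π / m))` are nonnegative for `-1 ≤ n < m`, where `m = 0` encodes
`m = ∞` and `cos (π / m)` is then replaced by `1`. -/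
theorem chebyshev_eval_neg_kform_nonneg (M : CoxeterMatrix B) {i j : B} (hij : i ≠ j) (n : ℤ)
    (hn : -1 ≤ n) (hM : M i j ≠ 0 → n < M i j) :
    0 ≤ (Polynomial.Chebyshev.U ℝ n).eval (-kform M i j) := by
  have hn' : (0 : ℝ) ≤ n + 1 := by exact_mod_cast (by lia : (0 : ℤ) ≤ n + 1)
  by_cases h0 : M i j = 0
  · simpa [kform, h0] using hn'
  · have h2 : (2 : ℝ) ≤ M i j := by
      have := M.off_diagonal i j hij
      exact_mod_cast (by lia : 2 ≤ M i j)
    have hm : (n : ℝ) + 1 ≤ M i j := by exact_mod_cast hM h0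
    have hθ : 0 < Real.pi / M i j := by positivity
    have hsin : 0 < Real.sin (Real.pi / M i j) :=
      Real.sin_pos_of_pos_of_lt_pi hθ (div_lt_self Real.pi_pos (by linarith))
    simp only [kform, h0, if_false, neg_neg]
    refine nonneg_of_mul_nonneg_left ?_ hsin
    rw [Polynomial.Chebyshev.U_real_cos]
    refine Real.sin_nonneg_of_nonneg_of_le_pi (by positivity) ?_
    calc ((n : ℝ) + 1) * (Real.pi / M i j) ≤ M i j * (Real.pi / M i j) := by gcongr
      _ = Real.pi := by field_simp

/-- An element `w` factors as `v * u`, where `u` is a nonempty alternating word ending in `j`,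
lengths add up, and `v` is the shortest element of its coset of the subgroup generated by
`s i`, `s j`. -/
theorem exists_eq_mul_alternatingWord {M : CoxeterMatrix B} (cs : CoxeterSystem M W) (w : W)
    (i j : B) (hj : cs.length (w * cs.simple j) < cs.length w) :
    ∃ (v : W) (k : ℕ), 0 < k ∧ w = v * cs.wordProd (CoxeterSystem.alternatingWord i j k) ∧
      cs.length v + k = cs.length w ∧ cs.length v < cs.length (v * cs.simple i) ∧
      cs.length v < cs.length (v * cs.simple j) := by
  classical
  let P : ℕ → Prop := fun k => ∃ v : W,
    w = v * cs.wordProd (CoxeterSystem.alternatingWord i j k) ∧ cs.length v + k = cs.length w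
  have hP1 : P 1 := by
    refine ⟨w * cs.simple j, by simp [CoxeterSystem.alternatingWord], ?_⟩
    rcases cs.length_mul_simple w j with h | h <;> lia
  have h1 : 1 ≤ cs.length w := by lia
  obtain ⟨k, hk⟩ : ∃ k, k = Nat.findGreatest P (cs.length w) := ⟨_, rfl⟩
  obtain ⟨v, hv, hl⟩ : P k := hk ▸ Nat.findGreatest_spec h1 hP1
  have hk0 : 1 ≤ k := hk ▸ Nat.le_findGreatest h1 hP1
  have hmax : ¬ P (k + 1) := fun h => by
    obtain ⟨v', -, hl'⟩ := id h
    have : k + 1 ≤ Nat.findGreatest P (cs.length w) := Nat.le_findGreatest (by lia) h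
    lia
  have hnext : cs.length v < cs.length (v * cs.simple (if Even k then j else i)) := by
    by_contra hlt
    refine hmax ⟨v * cs.simple (if Even k then j else i), ?_, ?_⟩
    · rw [CoxeterSystem.alternatingWord_succ', cs.wordProd_cons, hv]
      simp [mul_assoc]
    · rcases cs.length_mul_simple v (if Even k then j else i) with h | h <;> lia
  have hfirst : cs.length v < cs.length (v * cs.simple (if Even k then i else j)) := by
    by_contra hlt
    obtain ⟨n, rfl⟩ : ∃ n, k = n + 1 := ⟨k - 1, by lia⟩
    have hw : w = (v * cs.simple (if Even (n + 1) then i else j)) *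
        cs.wordProd (CoxeterSystem.alternatingWord i j n) := by
      rw [hv, CoxeterSystem.alternatingWord_succ', cs.wordProd_cons, mul_assoc]
      by_cases hn : Even n <;> simp [hn, Nat.even_add_one]
    have hle := cs.length_mul_le (v * cs.simple (if Even (n + 1) then i else j))
      (cs.wordProd (CoxeterSystem.alternatingWord i j n))
    have hle' := cs.length_wordProd_le (CoxeterSystem.alternatingWord i j n)
    rw [← hw] at hle
    rw [CoxeterSystem.length_alternatingWord] at hle'
    lia
  refine ⟨v, k, hk0, hv, hl, ?_⟩
  by_cases hk : Even k
  · simp only [hk, if_true] at hnext hfirst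
    exact ⟨hfirst, hnext⟩
  · simp only [hk, if_false] at hnext hfirst
    exact ⟨hnext, hfirst⟩

/-- If `v * u` is a length-additive factorization with `u` an alternating word of length `k`
ending in `j`, and `s i` is not a right descent of `v * u`, then `k < m i j`. -/
theorem lt_of_length_mul_alternatingWord {M : CoxeterMatrix B} (cs : CoxeterSystem M W) (v : W)
    (i j : B) (k : ℕ) (hM : M i j ≠ 0)
    (hl : cs.length v + k =
      cs.length (v * cs.wordProd (CoxeterSystem.alternatingWord i j k)))
    (hi : cs.length (v * cs.wordProd (CoxeterSystem.alternatingWord i j k)) <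
      cs.length (v * cs.wordProd (CoxeterSystem.alternatingWord i j k) * cs.simple i)) :
    k < M i j := by
  by_contra hlt
  rcases (not_lt.1 hlt).lt_or_eq with h | rfl
  · refine cs.not_isReduced_alternatingWord i j hM h ?_
    have h1 := cs.length_mul_le v (cs.wordProd (CoxeterSystem.alternatingWord i j k))
    have h2 := cs.length_wordProd_le (CoxeterSystem.alternatingWord i j k)
    rw [CoxeterSystem.length_alternatingWord] at h2
    rw [CoxeterSystem.IsReduced, CoxeterSystem.length_alternatingWord]
    lia
  · have hbraid := cs.prod_alternatingWord_eq_prod_alternatingWord_sub i j (M i j) (by lia)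
    obtain ⟨n, hn⟩ : ∃ n, M i j = n + 1 := ⟨M i j - 1, by lia⟩
    have hn' : M i j * 2 - M i j = n + 1 := by lia
    rw [hn', CoxeterSystem.alternatingWord_succ, cs.wordProd_concat] at hbraid
    have h1 := cs.length_mul_le v (cs.wordProd (CoxeterSystem.alternatingWord i j n))
    have h2 := cs.length_wordProd_le (CoxeterSystem.alternatingWord i j n)
    rw [CoxeterSystem.length_alternatingWord] at h2
    rw [← hl, hbraid] at hi
    simp only [mul_assoc, cs.simple_mul_simple_self, mul_one] at hi
    lia

namespace IsCanonicalRep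

variable {M : CoxeterMatrix B} {cs : CoxeterSystem M W}
  {ρ : W →* ((B →₀ ℝ) →ₗ[ℝ] (B →₀ ℝ))}

theorem apply_simple (hρ : IsCanonicalRep cs ρ) (i : B) (x : B →₀ ℝ) :
    ρ (cs.simple i) x = x - (2 * bform M x (esimple i)) • esimple i := by
  rw [hρ, sum_mul_kform]

theorem apply_simple_esimple_self (hρ : IsCanonicalRep cs ρ) (i : B) :
    ρ (cs.simple i) (esimple i) = -esimple i := by
  rw [hρ.apply_simple, bform_esimple_esimple, kform_self]
  module

theorem bform_apply_apply (hρ : IsCanonicalRep cs ρ) (w : W) (x y : B →₀ ℝ) :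
    bform M (ρ w x) (ρ w y) = bform M x y := by
  induction w using cs.simple_induction_left with
  | one => simp
  | mul_simple_left w i ih =>
    rw [← ih]
    simp only [map_mul, Module.End.mul_apply, hρ.apply_simple, map_sub, map_smul,
      LinearMap.sub_apply, LinearMap.smul_apply, bform_esimple_esimple, kform_self, smul_eq_mul]
    rw [bform_comm M (esimple i) (ρ w y)]
    ring

theorem apply_alternatingWord (hρ : IsCanonicalRep cs ρ) (i j : B) (k : ℕ) :
    ρ (cs.wordProd (CoxeterSystem.alternatingWord i j k)) (esimple i) =
      (Polynomial.Chebyshev.U ℝ k).eval (-kform M i j) • esimple (if Even k then i else j) +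
      (Polynomial.Chebyshev.U ℝ (k - 1)).eval (-kform M i j) •
        esimple (if Even k then j else i) := by
  induction k with
  | zero => simp [CoxeterSystem.alternatingWord]
  | succ k ih =>
    rw [CoxeterSystem.alternatingWord_succ', cs.wordProd_cons, map_mul, Module.End.mul_apply, ih]
    push_cast
    rw [Polynomial.Chebyshev.U_add_one, add_sub_cancel_right]
    by_cases hk : Even k
    · simp only [hk, Nat.even_add_one, not_true, if_true, if_false, map_add, map_smul,
        hρ.apply_simple_esimple_self]
      rw [hρ.apply_simple, bform_esimple_esimple]
      simp only [Polynomial.eval_sub, Polynomial.eval_mul, Polynomial.eval_ofNat,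
        Polynomial.eval_X]
      module
    · simp only [hk, Nat.even_add_one, not_false_eq_true, if_true, if_false, map_add, map_smul,
        hρ.apply_simple_esimple_self]
      rw [hρ.apply_simple, bform_esimple_esimple, kform_comm M j i]
      simp only [Polynomial.eval_sub, Polynomial.eval_mul, Polynomial.eval_ofNat,
        Polynomial.eval_X]
      module

/-- If `l(w s) > l(w)`, then `w e_s` is a nonnegative combination of the simple roots. -/
theorem apply_esimple_nonneg (hρ : IsCanonicalRep cs ρ) (w : W) (i : B)
    (h : cs.length w < cs.length (w * cs.simple i)) : 0 ≤ ρ w (esimple i) := by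
  induction hn : cs.length w using Nat.strong_induction_on generalizing w i with
  | _ n ih =>
    by_cases hw : w = 1
    · simpa [hw] using esimple_nonneg i
    obtain ⟨j, hj : cs.length (w * cs.simple j) < cs.length w⟩ :=
      cs.exists_rightDescent_of_ne_one hw
    have hij : i ≠ j := by
      rintro rfl
      exact lt_asymm h hj
    obtain ⟨v, k, hk, hv, hl, hvi, hvj⟩ := exists_eq_mul_alternatingWord cs w i j hj
    have hpi : 0 ≤ ρ v (esimple i) := ih _ (by lia) v i hvi rfl
    have hpj : 0 ≤ ρ v (esimple j) := ih _ (by lia) v j hvj rfl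
    have hkM : M i j ≠ 0 → k < M i j := fun hM => by
      rw [hv] at hl h
      exact lt_of_length_mul_alternatingWord cs v i j k hM hl h
    have hU := chebyshev_eval_neg_kform_nonneg M hij k (by lia) (by exact_mod_cast hkM)
    have hU' := chebyshev_eval_neg_kform_nonneg M hij (k - 1) (by lia)
      (fun hM => by have := hkM hM; lia)
    rw [hv, map_mul, Module.End.mul_apply, hρ.apply_alternatingWord, map_add, map_smul, map_smul]
    split_ifs
    · exact add_nonneg (smul_nonneg hU hpi) (smul_nonneg hU' hpj)
    · exact add_nonneg (smul_nonneg hU hpj) (smul_nonneg hU' hpi)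

theorem injective (hρ : IsCanonicalRep cs ρ) : Function.Injective ρ := by
  refine (injective_iff_map_eq_one ρ).2 fun w hw => ?_
  by_contra hne
  obtain ⟨i, hi : cs.length (w * cs.simple i) < cs.length w⟩ :=
    cs.exists_rightDescent_of_ne_one hne
  have hpos := hρ.apply_esimple_nonneg (w * cs.simple i) i (by simpa using hi)
  rw [map_mul, hw, one_mul, hρ.apply_simple_esimple_self] at hpos
  exact esimple_ne_zero i (le_antisymm (neg_nonneg.1 hpos) (esimple_nonneg i))

theorem apply_esimple_eq_iff (hρ : IsCanonicalRep cs ρ) (w : W) (i j : B) :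
    ρ w (esimple i) = esimple j ↔
      w * cs.simple i * w⁻¹ = cs.simple j ∧ cs.length w < cs.length (w * cs.simple i) := by
  constructor
  · intro h
    constructor
    · refine hρ.injective (LinearMap.ext fun x => ?_)
      have hinv : ρ w (ρ w⁻¹ x) = x := by
        rw [← Module.End.mul_apply, ← map_mul]
        simp
      rw [map_mul, map_mul, Module.End.mul_apply, Module.End.mul_apply, hρ.apply_simple,
        hρ.apply_simple, map_sub, map_smul, ← hρ.bform_apply_apply w, h, hinv]
    · by_contra hlt
      have hlt' : cs.length (w * cs.simple i) < cs.length w :=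
        (not_lt.1 hlt).lt_of_ne (cs.length_mul_simple_ne w i)
      have hpos := hρ.apply_esimple_nonneg (w * cs.simple i) i (by simpa using hlt')
      rw [map_mul, Module.End.mul_apply, hρ.apply_simple_esimple_self, map_neg, h] at hpos
      exact esimple_ne_zero j (le_antisymm (neg_nonneg.1 hpos) (esimple_nonneg j))
  · rintro ⟨hconj, hlt⟩
    have hneg : ρ (cs.simple j) (ρ w (esimple i)) = -ρ w (esimple i) := by
      rw [← hconj, ← Module.End.mul_apply, ← map_mul, inv_mul_cancel_right, map_mul,
        Module.End.mul_apply, hρ.apply_simple_esimple_self, map_neg]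
    obtain ⟨c, hc⟩ : ∃ c : ℝ, ρ w (esimple i) = c • esimple j := by
      refine ⟨bform M (ρ w (esimple i)) (esimple j), ?_⟩
      rw [hρ.apply_simple] at hneg
      linear_combination (norm := module) (1 / 2 : ℝ) • hneg
    have hnorm := hρ.bform_apply_apply w (esimple i) (esimple i)
    simp only [hc, map_smul, LinearMap.smul_apply, bform_esimple_esimple, kform_self, smul_eq_mul,
      mul_one] at hnorm
    have hpos := hρ.apply_esimple_nonneg w i hlt
    rw [hc] at hpos
    have hc0 : 0 ≤ c := by simpa [esimple] using hpos j
    have hc1 : c = 1 := by nlinarith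
    rw [hc, hc1, one_smul]

end IsCanonicalRep

/-- **Lemma 3.7.** `w (E_X) = E_{X'}` if and only if `w X w⁻¹ = X'` and `l(w s) > l(w)`
for all `s ∈ X`. -/
theorem map_esimple_set_iff {B W : Type*} [Group W]
    (M : CoxeterMatrix B) (cs : CoxeterSystem M W)
    (ρ : W →* ((B →₀ ℝ) →ₗ[ℝ] (B →₀ ℝ))) (hρ : IsCanonicalRep cs ρ)
    (X X' : Set B) (w : W) :
    ⇑(ρ w) '' (esimple '' X) = esimple '' X' ↔
      ((fun t => w * t * w⁻¹) '' (cs.simple '' X) = cs.simple '' X' ∧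
        ∀ b ∈ X, cs.length w < cs.length (w * cs.simple b)) := by
  simp only [Set.image_image]
  constructor
  · intro h
    have himg : ∀ b ∈ X, ∃ b' ∈ X', ρ w (esimple b) = esimple b' := fun b hb => by
      obtain ⟨b', hb', he⟩ := h.subset (Set.mem_image_of_mem _ hb)
      exact ⟨b', hb', he.symm⟩
    refine ⟨Set.Subset.antisymm ?_ ?_, fun b hb => ?_⟩
    · rintro _ ⟨b, hb, rfl⟩
      obtain ⟨b', hb', he⟩ := himg b hb
      exact ⟨b', hb', ((hρ.apply_esimple_eq_iff w b b').1 he).1.symm⟩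
    · rintro _ ⟨b', hb', rfl⟩
      obtain ⟨b, hb, he⟩ := h.superset (Set.mem_image_of_mem _ hb')
      exact ⟨b, hb, ((hρ.apply_esimple_eq_iff w b b').1 he).1⟩
    · obtain ⟨b', -, he⟩ := himg b hb
      exact ((hρ.apply_esimple_eq_iff w b b').1 he).2
  · rintro ⟨h, hlt⟩
    refine Set.Subset.antisymm ?_ ?_
    · rintro _ ⟨b, hb, rfl⟩
      obtain ⟨b', hb', he⟩ := h.subset (Set.mem_image_of_mem _ hb)
      exact ⟨b', hb', ((hρ.apply_esimple_eq_iff w b b').2 ⟨he.symm, hlt b hb⟩).symm⟩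
    · rintro _ ⟨b', hb', rfl⟩
      obtain ⟨b, hb, he⟩ := h.superset (Set.mem_image_of_mem _ hb')
      exact ⟨b, hb, (hρ.apply_esimple_eq_iff w b b').2 ⟨he, hlt b hb⟩⟩

end CoxeterCommensurator
end

section
/- Let (W,S) be a Coxeter system with canonical representation on V. For every w ∈ W and s ∈ S, one has l(ws) > l(w) if and only if the root w(e_s) is positive (i.e. all coordinates of w(e_s) in the basis {e_t : t ∈ S} are ≥ 0). -/
open scoped Pointwise

namespace CoxeterCommensurator

variable {B W : Type*} [Group W]

theorem IsCanonicalRep.simple_esimple {M : CoxeterMatrix B} {cs : CoxeterSystem M W}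
    {ρ : W →* ((B →₀ ℝ) →ₗ[ℝ] (B →₀ ℝ))} (hρ : IsCanonicalRep cs ρ) (i j : B) :
    ρ (cs.simple i) (esimple j) = esimple j - (2 * kform M j i) • esimple i := by
  rw [hρ]
  simp [esimple]

theorem IsCanonicalRep.simple_esimple_self {M : CoxeterMatrix B} {cs : CoxeterSystem M W}
    {ρ : W →* ((B →₀ ℝ) →ₗ[ℝ] (B →₀ ℝ))} (hρ : IsCanonicalRep cs ρ) (i : B) :
    ρ (cs.simple i) (esimple i) = -esimple i := by
  rw [hρ.simple_esimple, kform_self]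
  module

/-- The coefficients of the roots of a rank two subsystem, as values of Chebyshev polynomials of
the second kind at `-kform M i j`. -/
noncomputable def dihedralCoeff (M : CoxeterMatrix B) (i j : B) (k : ℕ) : ℝ :=
  (Polynomial.Chebyshev.U ℝ ((k : ℤ) - 1)).eval (-kform M i j)

theorem dihedralCoeff_zero (M : CoxeterMatrix B) (i j : B) : dihedralCoeff M i j 0 = 0 := by
  simp [dihedralCoeff]

theorem dihedralCoeff_one (M : CoxeterMatrix B) (i j : B) : dihedralCoeff M i j 1 = 1 := by
  simp [dihedralCoeff]

theorem dihedralCoeff_add_two (M : CoxeterMatrix B) (i j : B) (k : ℕ) :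
    dihedralCoeff M i j (k + 2) =
      -(2 * kform M i j) * dihedralCoeff M i j (k + 1) - dihedralCoeff M i j k := by
  have h := Polynomial.Chebyshev.U_add_two ℝ ((k : ℤ) - 1)
  have e₁ : ((k + 2 : ℕ) : ℤ) - 1 = (k : ℤ) - 1 + 2 := by push_cast; ring
  have e₂ : ((k + 1 : ℕ) : ℤ) - 1 = (k : ℤ) - 1 + 1 := by push_cast; ring
  simp only [dihedralCoeff, e₁, e₂, h]
  simp

theorem dihedralCoeff_nonneg (M : CoxeterMatrix B) {i j : B} (hij : i ≠ j) {k : ℕ}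
    (hk : M i j = 0 ∨ k ≤ M i j) : 0 ≤ dihedralCoeff M i j k := by
  rcases eq_or_ne (M i j) 0 with h0 | h0
  · simp [dihedralCoeff, kform, h0]
  · have hk' : k ≤ M i j := hk.resolve_left h0
    have h1 : M i j ≠ 1 := M.off_diagonal i j hij
    have hm : (2 : ℝ) ≤ M i j := by exact_mod_cast (show 2 ≤ M i j by omega)
    have hsin : 0 < Real.sin (Real.pi / M i j) := by
      apply Real.sin_pos_of_pos_of_lt_pi (by positivity)
      rw [div_lt_iff₀ (by linarith)]
      nlinarith [Real.pi_pos]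
    have key := Polynomial.Chebyshev.U_real_cos (Real.pi / M i j) ((k : ℤ) - 1)
    have hnn : 0 ≤ Real.sin (k * (Real.pi / M i j)) := by
      apply Real.sin_nonneg_of_nonneg_of_le_pi (by positivity)
      rw [mul_div_assoc', div_le_iff₀ (by linarith), mul_comm]
      gcongr
    have hc : -kform M i j = Real.cos (Real.pi / M i j) := by simp [kform, h0]
    rw [dihedralCoeff, hc]
    refine nonneg_of_mul_nonneg_left ?_ hsin
    rw [key]
    push_cast
    simpa using hnn

/-- The image of `e_i` under an alternating product of `s_i` and `s_j` ending in `s_j`. -/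
theorem IsCanonicalRep.alternatingWord_esimple {M : CoxeterMatrix B} {cs : CoxeterSystem M W}
    {ρ : W →* ((B →₀ ℝ) →ₗ[ℝ] (B →₀ ℝ))} (hρ : IsCanonicalRep cs ρ) (i j : B) (k : ℕ) :
    ρ (cs.wordProd (CoxeterSystem.alternatingWord i j k)) (esimple i) =
      if Even k then
        dihedralCoeff M i j (k + 1) • esimple i + dihedralCoeff M i j k • esimple j
      else dihedralCoeff M i j k • esimple i + dihedralCoeff M i j (k + 1) • esimple j := by
  induction k with
  | zero => simp [CoxeterSystem.alternatingWord, dihedralCoeff_zero, dihedralCoeff_one]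
  | succ k ih =>
    rw [CoxeterSystem.alternatingWord_succ', cs.wordProd_cons, map_mul, Module.End.mul_apply, ih,
      dihedralCoeff_add_two]
    by_cases hk : Even k
    · simp only [hk, Nat.even_add_one, not_true_eq_false, if_true, if_false, map_add, map_smul,
        hρ.simple_esimple_self, hρ.simple_esimple j i]
      module
    · simp only [hk, Nat.even_add_one, not_false_eq_true, if_true, if_false, map_add, map_smul,
        hρ.simple_esimple_self, hρ.simple_esimple i j, kform_comm M j i]
      module

/-- Factor `w` as `v * u` with lengths adding up, where `u` is the longest possible alternating
word in `s_i` and `s_j` ending in `s_j`. -/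
theorem exists_maximal_alternating_suffix {M : CoxeterMatrix B} (cs : CoxeterSystem M W)
    (w : W) (i j : B) (hj : cs.length (w * cs.simple j) < cs.length w) :
    ∃ (v : W) (k : ℕ), w = v * cs.wordProd (CoxeterSystem.alternatingWord i j k) ∧
      cs.length w = cs.length v + k ∧ 0 < k ∧
      cs.length v < cs.length (v * cs.simple i) ∧ cs.length v < cs.length (v * cs.simple j) := by
  classical
  let P : ℕ → Prop := fun k ↦ ∃ v : W,
    w = v * cs.wordProd (CoxeterSystem.alternatingWord i j k) ∧ cs.length w = cs.length v + k
  have hP₁ : P 1 := by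
    refine ⟨w * cs.simple j, by simp [CoxeterSystem.alternatingWord], ?_⟩
    have := cs.length_mul_simple w j
    omega
  have hle : 1 ≤ cs.length w := by omega
  have hpos : 1 ≤ Nat.findGreatest P (cs.length w) := Nat.le_findGreatest hle hP₁
  have hspec : P (Nat.findGreatest P (cs.length w)) := Nat.findGreatest_spec hle hP₁
  have hmax : ¬ P (Nat.findGreatest P (cs.length w) + 1) := fun h ↦ by
    have hb : Nat.findGreatest P (cs.length w) + 1 ≤ cs.length w := by
      obtain ⟨v, -, hv⟩ := h
      omega
    have := Nat.le_findGreatest hb h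
    omega
  obtain ⟨n, hn⟩ : ∃ n, Nat.findGreatest P (cs.length w) = n + 1 :=
    ⟨_, (Nat.sub_add_cancel hpos).symm⟩
  rw [hn] at hspec hmax
  obtain ⟨v, hwv, hlen⟩ := hspec
  have hnext : cs.length v < cs.length (v * cs.simple (if Even (n + 1) then j else i)) := by
    by_contra hlt
    refine hmax ⟨v * cs.simple (if Even (n + 1) then j else i), ?_, ?_⟩
    · rw [CoxeterSystem.alternatingWord_succ' i j (n + 1), cs.wordProd_cons, ← mul_assoc,
        cs.simple_mul_simple_cancel_right]
      exact hwv
    · have := cs.length_mul_simple v (if Even (n + 1) then j else i)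
      omega
  have hfirst : cs.length v < cs.length (v * cs.simple (if Even n then j else i)) := by
    have h₁ := cs.length_mul_le (v * cs.simple (if Even n then j else i))
      (cs.wordProd (CoxeterSystem.alternatingWord i j n))
    have h₂ := cs.length_wordProd_le (CoxeterSystem.alternatingWord i j n)
    rw [mul_assoc, ← cs.wordProd_cons, ← CoxeterSystem.alternatingWord_succ', ← hwv] at h₁
    rw [CoxeterSystem.length_alternatingWord] at h₂
    omega
  refine ⟨v, n + 1, hwv, hlen, n.succ_pos, ?_⟩
  by_cases hev : Even n
  · simp only [hev, Nat.even_add_one, not_true_eq_false, if_true, if_false] at hnext hfirst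
    exact ⟨hnext, hfirst⟩
  · simp only [hev, Nat.even_add_one, not_false_eq_true, if_true, if_false] at hnext hfirst
    exact ⟨hfirst, hnext⟩

theorem IsCanonicalRep.nonneg_of_length_lt {M : CoxeterMatrix B} {cs : CoxeterSystem M W}
    {ρ : W →* ((B →₀ ℝ) →ₗ[ℝ] (B →₀ ℝ))} (hρ : IsCanonicalRep cs ρ) (w : W) (i : B)
    (h : cs.length w < cs.length (w * cs.simple i)) : 0 ≤ ρ w (esimple i) := by
  induction hl : cs.length w using Nat.strong_induction_on generalizing w i with
  | _ l ih =>
  rcases eq_or_ne w 1 with rfl | hw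
  · simp [esimple]
  obtain ⟨j, hj⟩ := cs.exists_rightDescent_of_ne_one hw
  have hij : i ≠ j := by
    rintro rfl
    exact lt_asymm h hj
  obtain ⟨v, k, hwv, hlen, hk, hvi, hvj⟩ := exists_maximal_alternating_suffix cs w i j hj
  have hi₀ := ih _ (by omega) v i hvi rfl
  have hj₀ := ih _ (by omega) v j hvj rfl
  have hkm : M i j = 0 ∨ k + 1 ≤ M i j := by
    by_contra! hcon
    have hred := cs.not_isReduced_alternatingWord j i (m := k + 1)
      (by rw [M.symmetric]; exact hcon.1) (by rw [M.symmetric]; exact hcon.2)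
    apply hred
    have hle := cs.length_wordProd_le (CoxeterSystem.alternatingWord j i (k + 1))
    have hmul := cs.length_mul_le v
      (cs.wordProd (CoxeterSystem.alternatingWord j i (k + 1)))
    have heq : v * cs.wordProd (CoxeterSystem.alternatingWord j i (k + 1)) =
        w * cs.simple i := by
      rw [CoxeterSystem.alternatingWord_succ, cs.wordProd_concat, ← mul_assoc, ← hwv]
    rw [heq] at hmul
    rw [CoxeterSystem.IsReduced, CoxeterSystem.length_alternatingWord] at *
    omega
  have hc₁ := dihedralCoeff_nonneg M hij hkm
  have hc₀ := dihedralCoeff_nonneg M hij (k := k) (hkm.imp_right fun h ↦ by omega)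
  rw [hwv, map_mul, Module.End.mul_apply, hρ.alternatingWord_esimple]
  split_ifs <;> rw [map_add, map_smul, map_smul] <;>
    exact add_nonneg (smul_nonneg ‹_› ‹_›) (smul_nonneg ‹_› ‹_›)

/-- **Proposition 3.6 (Deodhar).** `l(w s) > l(w)` if and only if the root `w (e_s)` is
positive. -/
theorem length_mul_simple_lt_iff_positive_root {B W : Type*} [Group W]
    (M : CoxeterMatrix B) (cs : CoxeterSystem M W)
    (ρ : W →* ((B →₀ ℝ) →ₗ[ℝ] (B →₀ ℝ))) (hρ : IsCanonicalRep cs ρ) (w : W) (i : B) :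
    cs.length w < cs.length (w * cs.simple i) ↔ ∀ j, 0 ≤ (ρ w (esimple i)) j := by
  constructor
  · exact fun h ↦ hρ.nonneg_of_length_lt w i h
  · intro hpos
    by_contra hlt
    have hneg : 0 ≤ ρ (w * cs.simple i) (esimple i) := by
      apply hρ.nonneg_of_length_lt
      rw [cs.simple_mul_simple_cancel_right]
      exact lt_of_le_of_ne (not_lt.mp hlt) (cs.length_mul_simple_ne w i)
    rw [map_mul, Module.End.mul_apply, hρ.simple_esimple_self, map_neg] at hneg
    have hzero : ρ w (esimple i) = 0 := le_antisymm (neg_nonneg.mp hneg) hpos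
    have hinv : ρ w⁻¹ (ρ w (esimple i)) = esimple i := by
      rw [← Module.End.mul_apply, ← map_mul, inv_mul_cancel, map_one, Module.End.one_apply]
    rw [hzero, map_zero] at hinv
    simpa [esimple] using hinv.symm

end CoxeterCommensurator
end
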